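/- Let G act on the left on sets E and M, let φ : E → M be G-equivariant, and let Hor ⊆ M × M be a discrete connection on the G-set M with form Ad. Let G act diagonally on E × M by g • (ε, m) := (g • ε, g • m) and on E × G by g • (ε, w) := (g • ε, g w g⁻¹). Then the map (ε, m) ↦ (⟦(ε, Ad(φ(ε), m))⟧, ⟦m⟧) induces a well-defined bijection from the orbit space (E × M)/G onto ((E × G)/G) × (M/G). -/

import Mathlib

/-- A discrete connection on the `G`-set `M`. -/
structure DiscreteConnection (G M : Type*) [Group G] [MulAction G M] where
  Hor : Set (M × M)
  invariant : ∀ (g : G) (m₀ m₁ : M), (m₀, m₁) ∈ Hor → (g • m₀, g • m₁) ∈ Hor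
  Ad : M × M → G
  mem_hor_Ad : ∀ m₀ m₁ : M, (m₀, (Ad (m₀, m₁))⁻¹ • m₁) ∈ Hor
  Ad_unique : ∀ (m₀ m₁ : M) (g : G), (m₀, g⁻¹ • m₁) ∈ Hor → g = Ad (m₀, m₁)
  hd : M → Quotient (MulAction.orbitRel G M) → M
  mem_hor_hd : ∀ (m₀ : M) (r : Quotient (MulAction.orbitRel G M)), (m₀, hd m₀ r) ∈ Hor
  orbit_hd : ∀ (m₀ : M) (r : Quotient (MulAction.orbitRel G M)),
    Quotient.mk (MulAction.orbitRel G M) (hd m₀ r) = r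
  hd_unique : ∀ (m₀ m₁ : M) (r : Quotient (MulAction.orbitRel G M)),
    (m₀, m₁) ∈ Hor → Quotient.mk (MulAction.orbitRel G M) m₁ = r → m₁ = hd m₀ r

/-- The total space of the conjugate bundle: pairs `(ε, w) ∈ E × G` with the
`G`-action `g • (ε, w) = (g • ε, g w g⁻¹)`. -/
structure ConjPair (E G : Type*) where
  base : E
  grp : G

instance ConjPair.instSMul {G E : Type*} [Group G] [MulAction G E] : SMul G (ConjPair E G) :=
  ⟨fun g p => ⟨g • p.base, g * p.grp * g⁻¹⟩⟩

theorem ConjPair.smul_def {G E : Type*} [Group G] [MulAction G E] (g : G) (p : ConjPair E G) :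
    g • p = ⟨g • p.base, g * p.grp * g⁻¹⟩ := rfl

instance ConjPair.instMulAction {G E : Type*} [Group G] [MulAction G E] :
    MulAction G (ConjPair E G) where
  one_smul p := by simp [ConjPair.smul_def]
  mul_smul g h p := by simp [ConjPair.smul_def, mul_smul, mul_assoc]


namespace DiscreteConnection

variable {G M : Type*} [Group G] [MulAction G M]

theorem Ad_smul_smul (D : DiscreteConnection G M) (g : G) (m₀ m₁ : M) :
    D.Ad (g • m₀, g • m₁) = g * D.Ad (m₀, m₁) * g⁻¹ := by
  refine (D.Ad_unique _ _ _ ?_).symm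
  have h := D.invariant g _ _ (D.mem_hor_Ad m₀ m₁)
  simpa [mul_smul] using h

theorem Ad_smul_right (D : DiscreteConnection G M) (g : G) (m₀ m₁ : M) :
    D.Ad (m₀, g • m₁) = g * D.Ad (m₀, m₁) := by
  refine (D.Ad_unique _ _ _ ?_).symm
  simpa [mul_smul] using D.mem_hor_Ad m₀ m₁

theorem Ad_smul_of_mem_hor (D : DiscreteConnection G M) (g : G) {m₀ m₁ : M}
    (h : (m₀, m₁) ∈ D.Hor) : D.Ad (m₀, g • m₁) = g :=
  (D.Ad_unique _ _ _ (by simpa using h)).symm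

/-- Two points of the same orbit with equal discrete connection form relative to a common base
point coincide. -/
theorem eq_of_Ad_eq (D : DiscreteConnection G M) {m₀ m₁ m₂ : M}
    (hAd : D.Ad (m₀, m₁) = D.Ad (m₀, m₂)) (horb : m₁ ∈ MulAction.orbit G m₂) : m₁ = m₂ := by
  obtain ⟨g, rfl⟩ := horb
  have hg : g = 1 := by simpa [D.Ad_smul_right] using hAd
  simp [hg]

end DiscreteConnection

/-- The map `(ε, m) ↦ (⟦(ε, Ad(φ(ε), m))⟧, ⟦m⟧)` induces a well-defined bijection
`(E × M)/G ≅ ((E × G)/G) × (M/G)`, where `G` acts diagonally on `E × M` and by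
`g • (ε, w) = (g • ε, g w g⁻¹)` on `E × G`. -/
theorem quotient_prod_bijection_of_discreteConnection {G E M : Type*} [Group G]
    [MulAction G E] [MulAction G M]
    (φ : E → M) (hφ : ∀ (g : G) (ε : E), φ (g • ε) = g • φ ε)
    (D : DiscreteConnection G M) :
    ∃ F : Quotient (MulAction.orbitRel G (E × M)) →
        Quotient (MulAction.orbitRel G (ConjPair E G)) × Quotient (MulAction.orbitRel G M),
      Function.Bijective F ∧
      ∀ (ε : E) (m : M),
        F (Quotient.mk (MulAction.orbitRel G (E × M)) (ε, m)) =
          (Quotient.mk (MulAction.orbitRel G (ConjPair E G)) ⟨ε, D.Ad (φ ε, m)⟩,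
           Quotient.mk (MulAction.orbitRel G M) m) := by
  refine ⟨Quotient.lift (fun p ↦ (Quotient.mk _ ⟨p.1, D.Ad (φ p.1, p.2)⟩, Quotient.mk _ p.2)) ?_,
    ⟨?_, ?_⟩, fun _ _ ↦ rfl⟩
  · rintro _ ⟨ε, m⟩ ⟨g, rfl⟩
    refine Prod.ext (Quotient.sound ⟨g, ?_⟩) (Quotient.sound ⟨g, rfl⟩)
    simp [ConjPair.smul_def, hφ, D.Ad_smul_smul]
  · rintro ⟨ε, m⟩ ⟨ε', m'⟩ h
    obtain ⟨h₁, h₂⟩ := Prod.ext_iff.1 h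
    obtain ⟨g, hg⟩ := Quotient.exact h₁
    have horb : m ∈ MulAction.orbit G m' := Quotient.exact h₂
    obtain ⟨rfl, hAd⟩ := ConjPair.mk.inj hg
    refine Quotient.sound ⟨g, Prod.ext rfl (D.eq_of_Ad_eq (m₀ := φ (g • ε')) ?_ ?_)⟩
    · rw [← hAd, hφ]
      exact D.Ad_smul_smul g (φ ε') m'
    · exact MulAction.mem_orbit_of_mem_orbit g (MulAction.mem_orbit_symm.1 horb)
  · rintro ⟨⟨ε, w⟩, r⟩
    refine ⟨Quotient.mk _ (ε, w • D.hd (φ ε) r), Prod.ext ?_ ?_⟩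
    · exact congrArg (fun v ↦ Quotient.mk _ (ConjPair.mk ε v))
        (D.Ad_smul_of_mem_hor w (D.mem_hor_hd (φ ε) r))
    · exact (Quotient.sound (MulAction.mem_orbit _ w)).trans (D.orbit_hd (φ ε) r)
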